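/- arXiv:2405.07961 — 2 statements merged into one kernel-verified Lean document; each statement's English description precedes it below -/
import Mathlib

section
/- If u ∈ ℝ^V satisfies (L(σ)u)|_{Ω⁺} = 0 and u|_B = 0, then −𝒮(γ₁⁺u) + 𝒟⁺(γ₀u) = u·𝟙_{B ∪ Ω⁺}, where 𝟙_X denotes the indicator vector of X ⊆ V and the product is componentwise. -/
open Matrix BigOperators

noncomputable section

variable {V : Type*} [Fintype V] [DecidableEq V]

/-- Weighted graph Laplacian of a symmetric weight function. -/
def lap (σ : V → V → ℝ) : Matrix V V ℝ :=
  Matrix.of fun x y => if x = y then ∑ z, σ x z else -σ x y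

/-- Restriction matrix `R_X : ℝ^V → ℝ^X`. -/
def restr (X : Finset V) : Matrix {x // x ∈ X} V ℝ :=
  Matrix.of fun i j => if (i : V) = j then 1 else 0

/-- Green function `G = R_{V°}ᵀ (L[V°,V°])⁻¹ R_{V°}` with `V° = Bᶜ`. -/
def green (B : Finset V) (σ : V → V → ℝ) : Matrix V V ℝ :=
  (restr Bᶜ)ᵀ * (restr Bᶜ * lap σ * (restr Bᶜ)ᵀ)⁻¹ * restr Bᶜ

/-- Dirichlet trace operator `γ₀ = R_{∂Ω}`. -/
def gamma0 (dO : Finset V) : Matrix {x // x ∈ dO} V ℝ := restr dO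

/-- Exterior Neumann trace operator `γ₁⁺ = -R_{∂Ω} L(σ⁺)`. -/
def gamma1p (dO : Finset V) (σp : V → V → ℝ) : Matrix {x // x ∈ dO} V ℝ :=
  -(restr dO * lap σp)

/-- Interior Neumann trace operator `γ₁⁻ = R_{∂Ω} L(σ⁻)`. -/
def gamma1m (dO : Finset V) (σm : V → V → ℝ) : Matrix {x // x ∈ dO} V ℝ :=
  restr dO * lap σm

/-- Single layer potential `𝒮 = G γ₀ᵀ`. -/
def slp (B dO : Finset V) (σ : V → V → ℝ) : Matrix V {x // x ∈ dO} ℝ :=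
  green B σ * (gamma0 dO)ᵀ

/-- Exterior double layer potential `𝒟⁺ = G (γ₁⁺)ᵀ`. -/
def dlpP (B dO : Finset V) (σ σp : V → V → ℝ) : Matrix V {x // x ∈ dO} ℝ :=
  green B σ * (gamma1p dO σp)ᵀ

/-- Interior double layer potential `𝒟⁻ = G (γ₁⁻)ᵀ`. -/
def dlpM (B dO : Finset V) (σ σm : V → V → ℝ) : Matrix V {x // x ∈ dO} ℝ :=
  green B σ * (gamma1m dO σm)ᵀ

/-- Single layer boundary operator `S = γ₀ 𝒮`. -/
def Sop (B dO : Finset V) (σ : V → V → ℝ) : Matrix {x // x ∈ dO} {x // x ∈ dO} ℝ :=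
  gamma0 dO * slp B dO σ

/-- Double layer boundary operator `D = ½ γ₀ (𝒟⁺ + 𝒟⁻)`. -/
def Dop (B dO : Finset V) (σ σp σm : V → V → ℝ) : Matrix {x // x ∈ dO} {x // x ∈ dO} ℝ :=
  (1/2 : ℝ) • (gamma0 dO * (dlpP B dO σ σp + dlpM B dO σ σm))

/-- Adjoint double layer (Neumann–Poincaré) operator `D' = ½ (γ₁⁺ + γ₁⁻) 𝒮`. -/
def Dadj (B dO : Finset V) (σ σp σm : V → V → ℝ) : Matrix {x // x ∈ dO} {x // x ∈ dO} ℝ :=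
  (1/2 : ℝ) • ((gamma1p dO σp + gamma1m dO σm) * slp B dO σ)

/-- Hypersingular operator `H = -γ₁⁺ 𝒟⁻`. -/
def Hop (B dO : Finset V) (σ σp σm : V → V → ℝ) : Matrix {x // x ∈ dO} {x // x ∈ dO} ℝ :=
  -(gamma1p dO σp * dlpM B dO σ σm)

/-- Indicator vector of a node subset. -/
def ind (X : Finset V) : V → ℝ := fun x => if x ∈ X then 1 else 0

/-- The subgraph with node set `A` and edges `{x,y}` with `w x y > 0` is connected. -/
def connOn (A : Finset V) (w : V → V → ℝ) : Prop :=
  ∀ x ∈ A, ∀ y ∈ A, Relation.ReflTransGen (fun a b => a ∈ A ∧ b ∈ A ∧ 0 < w a b) x y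

theorem lap_mulVec_apply (σ : V → V → ℝ) (hdiag : ∀ x, σ x x = 0) (u : V → ℝ) (x : V) :
    (lap σ *ᵥ u) x = ∑ y, σ x y * (u x - u y) := by
  have h : ∀ y, lap σ x y * u y = (if x = y then (∑ z, σ x z) * u y else 0) - σ x y * u y := by
    intro y
    by_cases hxy : x = y
    · subst hxy
      simp [lap, hdiag]
    · simp [lap, hxy]
  simp [mulVec, dotProduct, h, mul_sub, Finset.sum_mul]

theorem restr_mulVec_apply (X : Finset V) (u : V → ℝ) (i : {x // x ∈ X}) :
    (restr X *ᵥ u) i = u i := by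
  simp [restr, mulVec, dotProduct]

theorem restr_transpose_mulVec_restr_mulVec (X : Finset V) (u : V → ℝ) :
    (restr X)ᵀ *ᵥ (restr X *ᵥ u) = u * ind X := by
  ext x
  have h : ∀ i : {x // x ∈ X},
      (restr X)ᵀ x i * (restr X *ᵥ u) i = if (i : V) = x then u i else 0 := by
    intro i
    rw [restr_mulVec_apply]
    simp [restr]
  change ∑ i, (restr X)ᵀ x i * (restr X *ᵥ u) i = _
  rw [Finset.sum_congr rfl fun i _ => h i,
    Finset.sum_coe_sort X fun i => if i = x then u i else 0]
  simp [ind]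

/-- `green B σ` recovers a vector vanishing on `B` from its Laplacian off `B`. -/
theorem green_mulVec_eq (B : Finset V) (σ : V → V → ℝ)
    (hdet : IsUnit (restr Bᶜ * lap σ * (restr Bᶜ)ᵀ).det) (v w : V → ℝ)
    (hv : ∀ x ∈ B, v x = 0) (hw : ∀ x ∉ B, w x = (lap σ *ᵥ v) x) :
    green B σ *ᵥ w = v := by
  have hvB : (restr Bᶜ)ᵀ *ᵥ (restr Bᶜ *ᵥ v) = v := by
    rw [restr_transpose_mulVec_restr_mulVec]
    ext x
    by_cases hx : x ∈ B <;> simp [ind, hx, hv]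
  have hwB : restr Bᶜ *ᵥ w = (restr Bᶜ * lap σ * (restr Bᶜ)ᵀ) *ᵥ (restr Bᶜ *ᵥ v) := by
    rw [← mulVec_mulVec, hvB, ← mulVec_mulVec]
    ext i
    rw [restr_mulVec_apply, restr_mulVec_apply, hw _ (Finset.mem_compl.mp i.2)]
  rw [green, ← mulVec_mulVec, hwB, ← mulVec_mulVec, mulVec_mulVec _ _⁻¹,
    nonsing_inv_mul _ hdet, one_mulVec, hvB]

theorem lap_transpose (σ : V → V → ℝ) (hsymm : ∀ x y, σ x y = σ y x) : (lap σ)ᵀ = lap σ := by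
  ext x y
  by_cases h : x = y
  · simp [h]
  · simp [lap, h, Ne.symm h, hsymm x y]

theorem layer_potentials_eq_green_mulVec (B dO : Finset V) (σ σp : V → V → ℝ)
    (hsymm : ∀ x y, σp x y = σp y x) (u : V → ℝ) :
    -(slp B dO σ *ᵥ (gamma1p dO σp *ᵥ u)) + dlpP B dO σ σp *ᵥ (gamma0 dO *ᵥ u)
      = green B σ *ᵥ ((lap σp *ᵥ u) * ind dO - lap σp *ᵥ (u * ind dO)) := by
  rw [slp, dlpP, gamma1p, gamma0, transpose_neg, transpose_mul, lap_transpose σp hsymm,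
    neg_mulVec, mulVec_neg, neg_neg, Matrix.mul_neg, neg_mulVec, ← sub_eq_add_neg, mulVec_sub,
    ← restr_transpose_mulVec_restr_mulVec, ← restr_transpose_mulVec_restr_mulVec]
  simp only [mulVec_mulVec, Matrix.mul_assoc]

theorem stmt_3
    {V : Type*} [Fintype V] [DecidableEq V]
    (B Op dO Om : Finset V)
    (hBne : B.Nonempty) (hOpne : Op.Nonempty) (hdOne : dO.Nonempty) (hOmne : Om.Nonempty)
    (hd1 : Disjoint B Op) (hd2 : Disjoint B dO) (hd3 : Disjoint B Om)
    (hd4 : Disjoint Op dO) (hd5 : Disjoint Op Om) (hd6 : Disjoint dO Om)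
    (hcover : B ∪ Op ∪ dO ∪ Om = Finset.univ)
    (σ σp σm : V → V → ℝ)
    (hσsymm : ∀ x y, σ x y = σ y x) (hσdiag : ∀ x, σ x x = 0)
    (hσnn : ∀ x y, 0 ≤ σ x y)
    (hsepBdO : ∀ x ∈ B, ∀ y ∈ dO, σ x y = 0)
    (hsepBOm : ∀ x ∈ B, ∀ y ∈ Om, σ x y = 0)
    (hsepOpOm : ∀ x ∈ Op, ∀ y ∈ Om, σ x y = 0)
    (hσpsymm : ∀ x y, σp x y = σp y x) (hσpdiag : ∀ x, σp x x = 0)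
    (hσmsymm : ∀ x y, σm x y = σm y x) (hσmdiag : ∀ x, σm x x = 0)
    (hσpnn : ∀ x y, 0 ≤ σp x y) (hσmnn : ∀ x y, 0 ≤ σm x y)
    (hsum : ∀ x y, σp x y + σm x y = σ x y)
    (hp1 : ∀ x y, x ∈ B ∪ Op ∨ y ∈ B ∪ Op → σp x y = σ x y)
    (hm1 : ∀ x y, x ∈ Om ∨ y ∈ Om → σm x y = σ x y)
    (hpd : (restr Bᶜ * lap σ * (restr Bᶜ)ᵀ).PosDef) :
    ∀ u : V → ℝ, (∀ x ∈ Op, (lap σ *ᵥ u) x = 0) → (∀ x ∈ B, u x = 0) →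
      -(slp B dO σ *ᵥ (gamma1p dO σp *ᵥ u)) + dlpP B dO σ σp *ᵥ (gamma0 dO *ᵥ u)
        = u * ind (B ∪ Op) := by
  intro u hu huB
  rw [layer_potentials_eq_green_mulVec B dO σ σp hσpsymm]
  have hpOm : ∀ x y, x ∈ Om ∨ y ∈ Om → σp x y = 0 := fun x y h => by
    linarith [hsum x y, hm1 x y h]
  have hcases : ∀ x, (x ∈ B ∧ x ∉ Op ∧ x ∉ dO ∧ x ∉ Om) ∨ (x ∉ B ∧ x ∈ Op ∧ x ∉ dO ∧ x ∉ Om) ∨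
      (x ∉ B ∧ x ∉ Op ∧ x ∈ dO ∧ x ∉ Om) ∨ (x ∉ B ∧ x ∉ Op ∧ x ∉ dO ∧ x ∈ Om) := by
    intro x
    have hx := Finset.mem_univ x
    simp only [← hcover, Finset.mem_union] at hx
    rw [Finset.disjoint_left] at hd1 hd2 hd3 hd4 hd5 hd6
    grind
  refine green_mulVec_eq B σ (isUnit_iff_ne_zero.mpr hpd.det_pos.ne') _ _ ?_ ?_
  · intro x hx
    simp [huB x hx]
  intro x hxB
  simp only [Pi.sub_apply, Pi.mul_apply]
  rw [lap_mulVec_apply σp hσpdiag, lap_mulVec_apply σp hσpdiag, lap_mulVec_apply σ hσdiag]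
  rcases hcases x with hx | hx | hx | hx
  · exact absurd hx.1 hxB
  · have h := hu x hx.2.1
    rw [lap_mulVec_apply σ hσdiag] at h
    rw [← sub_eq_zero, ← neg_eq_zero, ← h]
    simp only [ind, hx, if_false, mul_zero, zero_sub, neg_sub, sub_neg_eq_add]
    rw [← Finset.sum_add_distrib]
    refine Finset.sum_congr rfl fun y _ => ?_
    have hp := hp1 x y (by simp [hx])
    rcases hcases y with hy | hy | hy | hy
    · simp [ind, hx, hy, huB y hy.1]
    · simp [ind, hx, hy]
    · simp [ind, hx, hy, hp]
      ring
    · simp [hsepOpOm x hx.2.1 y hy.2.2.2, hpOm x y (by simp [hy])]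
  · simp only [ind, hx, if_true, mul_one]
    rw [← Finset.sum_sub_distrib]
    refine Finset.sum_congr rfl fun y _ => ?_
    rcases hcases y with hy | hy | hy | hy
    · simp [ind, hx, hy, huB y hy.1]
    · simp [ind, hx, hy, hp1 x y (by simp [hy])]
      ring
    · simp [ind, hx, hy]
    · simp [ind, hx, hy, hpOm x y (by simp [hy])]
  · have h0 : ∀ y, σp x y = 0 := fun y => hpOm x y (by simp [hx])
    simp only [h0, zero_mul, Finset.sum_const_zero, sub_zero]
    symm
    refine Finset.sum_eq_zero fun y _ => ?_
    rcases hcases y with hy | hy | hy | hy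
    · simp [ind, hx, hy, huB y hy.1]
    · simp [hσsymm x y, hsepOpOm y hy.2.1 x hx.2.2.2]
    · simp [ind, hx, hy]
    · simp [ind, hx, hy]
end
end

section
/- For every f ∈ ℝ^{∂Ω}, the vector u = 𝒮 S⁻¹ f solves the interior Dirichlet problem: (L(σ⁻)u)|_{Ω⁻} = 0 and u|_{∂Ω} = f. Moreover the solution is unique on ∂Ω ∪ Ω⁻: any u' ∈ ℝ^V with (L(σ⁻)u')|_{Ω⁻} = 0 and u'|_{∂Ω} = f satisfies u'|_{∂Ω ∪ Ω⁻} = u|_{∂Ω ∪ Ω⁻}. -/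
open Matrix BigOperators

noncomputable section

variable {V : Type*} [Fintype V] [DecidableEq V]

@[simp]
lemma restr_mulVec {V : Type*} [Fintype V] [DecidableEq V] (X : Finset V) (v : V → ℝ)
    (i : {x // x ∈ X}) : (restr X *ᵥ v) i = v i := by
  simp [restr, Matrix.mulVec, dotProduct]

lemma restr_transpose_mulVec {V : Type*} [Fintype V] [DecidableEq V] (X : Finset V)
    (g : {x // x ∈ X} → ℝ) (y : V) :
    ((restr X)ᵀ *ᵥ g) y = if h : y ∈ X then g ⟨y, h⟩ else 0 := by
  simp only [restr, Matrix.mulVec, dotProduct, Matrix.transpose_apply, Matrix.of_apply, ite_mul,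
    one_mul, zero_mul]
  split_ifs with h
  · rw [Finset.sum_eq_single ⟨y, h⟩]
    · simp
    · intro b _ hb
      exact if_neg fun e => hb (Subtype.ext e)
    · simp
  · exact Finset.sum_eq_zero fun i _ => if_neg fun e : (i : V) = y => h (e ▸ i.2)

lemma restr_transpose_mulVec_restr_mulVec_s11 {V : Type*} [Fintype V] [DecidableEq V] {X : Finset V}
    {v : V → ℝ} (hv : ∀ x, x ∉ X → v x = 0) : (restr X)ᵀ *ᵥ (restr X *ᵥ v) = v := by
  ext y
  rw [restr_transpose_mulVec]
  split_ifs with h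
  · simp
  · exact (hv y h).symm

/-- The Green function inverts the Laplacian on the complement of `B`. -/
lemma restr_mul_lap_mul_green {V : Type*} [Fintype V] [DecidableEq V] {B : Finset V}
    {σ : V → V → ℝ} (hpd : (restr Bᶜ * lap σ * (restr Bᶜ)ᵀ).PosDef) :
    restr Bᶜ * lap σ * green B σ = restr Bᶜ := by
  have hdet := (Matrix.isUnit_iff_isUnit_det _).1 hpd.isUnit
  rw [green, ← Matrix.mul_assoc, ← Matrix.mul_assoc, Matrix.mul_nonsing_inv _ hdet,
    Matrix.one_mul]

lemma Sop_posDef {V : Type*} [Fintype V] [DecidableEq V] {B dO : Finset V} {σ : V → V → ℝ}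
    (hBdO : Disjoint B dO) (hpd : (restr Bᶜ * lap σ * (restr Bᶜ)ᵀ).PosDef) :
    (Sop B dO σ).PosDef := by
  have hinj : Function.Injective (restr Bᶜ * (restr dO)ᵀ).mulVec := by
    intro g g' h
    ext i
    have hi : (i : V) ∈ Bᶜ := Finset.mem_compl.2 (Finset.disjoint_right.1 hBdO i.2)
    have := congrFun h ⟨i, hi⟩
    simpa [← Matrix.mulVec_mulVec, restr_transpose_mulVec] using this
  have := hpd.inv.conjTranspose_mul_mul_same hinj
  simpa [Sop, slp, green, gamma0, Matrix.conjTranspose_eq_transpose_of_trivial,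
    Matrix.transpose_mul, Matrix.mul_assoc] using this

/-- A vector supported off `B`, and harmonic on its support, vanishes. -/
lemma eq_zero_of_lap_mulVec_eq_zero {V : Type*} [Fintype V] [DecidableEq V] {B : Finset V}
    {σ : V → V → ℝ} (hpd : (restr Bᶜ * lap σ * (restr Bᶜ)ᵀ).PosDef) {w : V → ℝ}
    (hB : ∀ x ∈ B, w x = 0) (hw : ∀ x, w x ≠ 0 → (lap σ *ᵥ w) x = 0) : w = 0 := by
  have hRR := restr_transpose_mulVec_restr_mulVec_s11 (X := Bᶜ) (v := w)
    fun x hx => hB x (by simpa using hx)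
  have hR : restr Bᶜ *ᵥ w = 0 := by
    by_contra hne
    have hpos := hpd.dotProduct_mulVec_pos hne
    rw [← Matrix.mulVec_mulVec, hRR, ← Matrix.mulVec_mulVec] at hpos
    refine hpos.ne' (Finset.sum_eq_zero fun i _ => ?_)
    by_cases h : w i = 0
    · simp [h]
    · simp [hw i h]
  rw [← hRR, hR, Matrix.mulVec_zero]

theorem stmt_11
    {V : Type*} [Fintype V] [DecidableEq V]
    (B Op dO Om : Finset V)
    (hBne : B.Nonempty) (hOpne : Op.Nonempty) (hdOne : dO.Nonempty) (hOmne : Om.Nonempty)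
    (hd1 : Disjoint B Op) (hd2 : Disjoint B dO) (hd3 : Disjoint B Om)
    (hd4 : Disjoint Op dO) (hd5 : Disjoint Op Om) (hd6 : Disjoint dO Om)
    (hcover : B ∪ Op ∪ dO ∪ Om = Finset.univ)
    (σ σp σm : V → V → ℝ)
    (hσsymm : ∀ x y, σ x y = σ y x) (hσdiag : ∀ x, σ x x = 0)
    (hσnn : ∀ x y, 0 ≤ σ x y)
    (hsepBdO : ∀ x ∈ B, ∀ y ∈ dO, σ x y = 0)
    (hsepBOm : ∀ x ∈ B, ∀ y ∈ Om, σ x y = 0)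
    (hsepOpOm : ∀ x ∈ Op, ∀ y ∈ Om, σ x y = 0)
    (hσpsymm : ∀ x y, σp x y = σp y x) (hσpdiag : ∀ x, σp x x = 0)
    (hσmsymm : ∀ x y, σm x y = σm y x) (hσmdiag : ∀ x, σm x x = 0)
    (hσpnn : ∀ x y, 0 ≤ σp x y) (hσmnn : ∀ x y, 0 ≤ σm x y)
    (hsum : ∀ x y, σp x y + σm x y = σ x y)
    (hp1 : ∀ x y, x ∈ B ∪ Op ∨ y ∈ B ∪ Op → σp x y = σ x y)
    (hm1 : ∀ x y, x ∈ Om ∨ y ∈ Om → σm x y = σ x y)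
    (hpd : (restr Bᶜ * lap σ * (restr Bᶜ)ᵀ).PosDef) :
    ∀ f : {x // x ∈ dO} → ℝ, ∀ u : V → ℝ,
      u = slp B dO σ *ᵥ ((Sop B dO σ)⁻¹ *ᵥ f) →
      ((∀ x ∈ Om, (lap σm *ᵥ u) x = 0)
      ∧ gamma0 dO *ᵥ u = f
      ∧ ∀ u' : V → ℝ, (∀ x ∈ Om, (lap σm *ᵥ u') x = 0) → gamma0 dO *ᵥ u' = f →
          ∀ x ∈ dO ∪ Om, u' x = u x) := by
  intro f u hu
  have hrow : ∀ x ∈ Om, ∀ v : V → ℝ, (lap σm *ᵥ v) x = (lap σ *ᵥ v) x := fun x hx v => by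
    simp [lap, Matrix.mulVec, dotProduct, hm1 x _ (Or.inl hx)]
  have hdet := (Matrix.isUnit_iff_isUnit_det _).1 (Sop_posDef hd2 hpd).isUnit
  have htrace : gamma0 dO *ᵥ u = f := by
    rw [hu, Matrix.mulVec_mulVec, ← Sop, Matrix.mulVec_mulVec, Matrix.mul_nonsing_inv _ hdet,
      Matrix.one_mulVec]
  have hharm : ∀ x ∈ Om, (lap σm *ᵥ u) x = 0 := by
    intro x hx
    have hxB : x ∈ Bᶜ := Finset.mem_compl.2 (Finset.disjoint_right.1 hd3 hx)
    have hxdO : x ∉ dO := Finset.disjoint_right.1 hd6 hx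
    rw [hrow x hx, ← restr_mulVec Bᶜ (lap σ *ᵥ u) ⟨x, hxB⟩, hu, Matrix.mulVec_mulVec, Matrix.mulVec_mulVec,
      slp, ← Matrix.mul_assoc, restr_mul_lap_mul_green hpd,
      ← Matrix.mulVec_mulVec, restr_mulVec, gamma0, restr_transpose_mulVec, dif_neg hxdO]
  refine ⟨hharm, htrace, fun u' hu' htr' => ?_⟩
  have hdO : ∀ x ∈ dO, u' x = u x := fun x hx => by
    simpa [gamma0] using congrFun (htr'.trans htrace.symm) ⟨x, hx⟩
  let w : V → ℝ := fun x => if x ∈ Om then u' x - u x else 0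
  have hw : w = 0 := by
    refine eq_zero_of_lap_mulVec_eq_zero hpd
      (fun x hx => if_neg (Finset.disjoint_left.1 hd3 hx)) fun x hx => ?_
    have hxOm : x ∈ Om := by
      by_contra h
      exact hx (if_neg h)
    have hdiff : (lap σ *ᵥ (u' - u)) x = 0 := by
      rw [← hrow x hxOm, Matrix.mulVec_sub, Pi.sub_apply, hu' x hxOm, hharm x hxOm, sub_zero]
    rw [← hdiff]
    refine Finset.sum_congr rfl fun y _ => ?_
    by_cases hy : y ∈ Om
    · simp [w, hy]
    by_cases hy' : y ∈ dO
    · simp [w, hy, hdO y hy']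
    have hxy : x ≠ y := fun e => hy (e ▸ hxOm)
    have hcov := Finset.mem_univ y
    rw [← hcover] at hcov
    have hσ : σ x y = 0 := by
      rw [hσsymm]
      rcases (by simpa [hy, hy'] using hcov : y ∈ B ∨ y ∈ Op) with h | h
      · exact hsepBOm y h x hxOm
      · exact hsepOpOm y h x hxOm
    simp [lap, hxy, hσ]
  intro x hx
  rcases Finset.mem_union.1 hx with h | h
  · exact hdO x h
  · simpa [w, h, sub_eq_zero] using congrFun hw x
end
end
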